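/- Let Y be a separable Banach space, p ∈ {0} ∪ [1,+∞), q ∈ [1,+∞), and let (Z_n,d_n), n ∈ ℕ, be a sequence of finite metric spaces. If E((Z_n)_{n∈ℕ},p) is Borel reducible to E(Y,q), then there exist strictly increasing sequences of natural numbers (b_j)_{j∈ℕ} and (l_j)_{j∈ℕ} and maps T_j : Z_{b_j} → Y^{l_{j+1}−l_j} such that for all x,y ∈ Π_{j∈ℕ} Z_{b_j}: (x,y) ∈ E((Z_{b_j})_{j∈ℕ},p) iff Σ_{j∈ℕ} ‖T_j(x(j))−T_j(y(j))‖_{Y,q}^q < +∞, where for a finite tuple s ∈ Y^m, ‖s‖_{Y,q} = (Σ_{i=1}^m ‖s(i)‖_Y^q)^{1/q}. -/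

import Mathlib

open Filter Topology MeasureTheory
open scoped ENNReal NNReal

noncomputable section

/-- `E` is Borel reducible to `F`: there is a Borel (measurable) map `θ` such that
`E x y ↔ F (θ x) (θ y)` for all `x, y`. -/
def BorelReducible {α β : Type*} [MeasurableSpace α] [MeasurableSpace β]
    (E : α → α → Prop) (F : β → β → Prop) : Prop :=
  ∃ θ : α → β, Measurable θ ∧ ∀ x y, E x y ↔ F (θ x) (θ y)

/-- replace the first `k` coordinates of `y` by `r`. -/
def dhMod {Z : ℕ → Type*} (k : ℕ) (r : ∀ i : Fin k, Z i) (y : ∀ n, Z n) : ∀ n, Z n :=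
  fun i => if h : i < k then r ⟨i, h⟩ else y i

lemma dhMod_lt {Z : ℕ → Type*} {k : ℕ} {r : ∀ i : Fin k, Z i} {y : ∀ n, Z n} {i : ℕ}
    (h : i < k) : dhMod k r y i = r ⟨i, h⟩ := by simp [dhMod, h]

lemma dhMod_ge {Z : ℕ → Type*} {k : ℕ} {r : ∀ i : Fin k, Z i} {y : ∀ n, Z n} {i : ℕ}
    (h : k ≤ i) : dhMod k r y i = y i := by simp [dhMod, not_lt.2 h]

lemma dhMod_comp {Z : ℕ → Type*} (j k : ℕ) (s : ∀ i : Fin j, Z i) (r : ∀ i : Fin k, Z i)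
    (y : ∀ n, Z n) :
    dhMod j s (dhMod k r y) = dhMod (max j k) (fun i => dhMod j s (dhMod k r y) i) y := by
  funext i
  by_cases h : i < max j k
  · rw [dhMod_lt h]
  · rw [dhMod_ge (not_lt.1 h), dhMod_ge (by omega), dhMod_ge (by omega)]

lemma dhMod_continuous {Z : ℕ → Type*} [∀ n, TopologicalSpace (Z n)] (k : ℕ)
    (r : ∀ i : Fin k, Z i) : Continuous (dhMod k r) := by
  refine continuous_pi fun i => ?_
  by_cases h : i < k
  · simp only [dhMod_lt h]; exact continuous_const
  · simp only [dhMod_ge (not_lt.1 h)]; exact continuous_apply i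

lemma dh_nhds {Z : ℕ → Type*} [∀ n, TopologicalSpace (Z n)] [∀ n, DiscreteTopology (Z n)]
    {x : ∀ n, Z n} {s : Set (∀ n, Z n)} (hs : s ∈ 𝓝 x) :
    ∀ᶠ N in atTop, ∀ y : ∀ n, Z n, (∀ i < N, y i = x i) → y ∈ s := by
  obtain ⟨t, ⟨z, n, rfl⟩, hx, ht⟩ := (PiNat.isTopologicalBasis_cylinders Z).mem_nhds_iff.1 hs
  filter_upwards [eventually_ge_atTop n] with N hN y hy
  apply ht
  rw [PiNat.mem_cylinder_iff] at hx ⊢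
  intro i hi
  rw [hy i (by omega), hx i hi]

lemma dh_cyl_nhds {Z : ℕ → Type*} [∀ n, TopologicalSpace (Z n)] [∀ n, DiscreteTopology (Z n)]
    (x : ∀ n, Z n) (N : ℕ) : {y : ∀ n, Z n | ∀ i < N, y i = x i} ∈ 𝓝 x :=
  (PiNat.isOpen_cylinder Z x N).mem_nhds (PiNat.self_mem_cylinder x N)

lemma dhMod_dense {Z : ℕ → Type*} [∀ n, TopologicalSpace (Z n)] [∀ n, DiscreteTopology (Z n)]
    (k : ℕ) (r : ∀ i : Fin k, Z i) {U : Set (∀ n, Z n)} (hU : Dense U) :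
    Dense (dhMod k r ⁻¹' U) := by
  intro x
  rw [mem_closure_iff_nhds]
  intro t ht
  obtain ⟨N, hN⟩ := (dh_nhds ht).exists
  obtain ⟨u, hu, hUu⟩ := mem_closure_iff_nhds.1 (hU (dhMod k r x)) _
    (dh_cyl_nhds (dhMod k r x) (max N k))
  refine ⟨dhMod k (fun i => x i) u, hN _ ?_, ?_⟩
  · intro i hi
    by_cases h : i < k
    · rw [dhMod_lt h]
    · rw [dhMod_ge (not_lt.1 h), hu i (by omega), dhMod_ge (not_lt.1 h)]
  · have : dhMod k r (dhMod k (fun i => x i) u) = u := by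
      funext i
      by_cases h : i < k
      · rw [dhMod_lt h, hu i (by omega), dhMod_lt h]
      · rw [dhMod_ge (not_lt.1 h), dhMod_ge (not_lt.1 h)]
    rw [Set.mem_preimage, this]; exact hUu

/-- Borel maps are continuous on a comeager set. -/
lemma dh_continuousOn {X W : Type*} [TopologicalSpace X] [MeasurableSpace X] [BorelSpace X]
    [TopologicalSpace W] [SecondCountableTopology W] [MeasurableSpace W] [OpensMeasurableSpace W]
    (f : X → W) (hf : Measurable f) : ∃ G ∈ residual X, ContinuousOn f G := by
  let B := TopologicalSpace.countableBasis W
  have hB := TopologicalSpace.isBasis_countableBasis W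
  have hc : Countable B := (TopologicalSpace.countable_countableBasis W).to_subtype
  have h1 : ∀ s : B, ∃ u : Set X, IsOpen u ∧ (f ⁻¹' s.1) =ᶠ[residual X] u := fun s =>
    (hf (hB.isOpen s.2).measurableSet).residualEq_isOpen
  choose u hu hfu using h1
  refine ⟨{x | ∀ s : B, (x ∈ f ⁻¹' s.1 ↔ x ∈ u s)}, ?_, ?_⟩
  · have : ∀ᶠ x in residual X, ∀ s : B, (x ∈ f ⁻¹' s.1 ↔ x ∈ u s) := by
      rw [eventually_countable_forall]
      intro s
      exact (hfu s).mem_iff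
    exact this
  · intro x hx
    rw [ContinuousWithinAt, hB.nhds_hasBasis.tendsto_right_iff]
    rintro s ⟨hs, hxs⟩
    have : u ⟨s, hs⟩ ∈ 𝓝 x := (hu _).mem_nhds ((hx ⟨s, hs⟩).1 hxs)
    filter_upwards [mem_nhdsWithin_of_mem_nhds this, self_mem_nhdsWithin] with y hy hyG
    exact (hyG ⟨s, hs⟩).2 hy

lemma dh_summable_tail {f : ℕ → ℝ} (hf : Summable f) (h0 : ∀ i, 0 ≤ f i) {ε : ℝ} (hε : 0 < ε) :
    ∀ᶠ l in atTop, ∀ M, ∑ i ∈ Finset.Ico l M, f i ≤ ε := by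
  have h := hf.hasSum.tendsto_sum_nat.eventually (lt_mem_nhds (sub_lt_self _ hε))
  filter_upwards [h] with l hl M
  rcases le_total l M with hM | hM
  · rw [Finset.sum_Ico_eq_sub _ hM]
    have := hf.sum_le_tsum (Finset.range M) (fun i _ => h0 i)
    linarith
  · rw [Finset.Ico_eq_empty_of_le hM]; simpa using hε.le

lemma dh_rpow {q : ℝ} (hq : 1 ≤ q) {Y : Type*} [NormedAddCommGroup Y] (a b c : Y) :
    ‖a - c‖ ^ q ≤ 2 ^ q * (‖a - b‖ ^ q + ‖b - c‖ ^ q) := by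
  have hq0 : 0 ≤ q := by linarith
  have h1 : ‖a - c‖ ≤ 2 * max ‖a - b‖ ‖b - c‖ := by
    have := norm_sub_le_norm_sub_add_norm_sub a b c
    have := le_max_left ‖a - b‖ ‖b - c‖
    have := le_max_right ‖a - b‖ ‖b - c‖
    linarith
  have h2 : (max ‖a - b‖ ‖b - c‖) ^ q ≤ ‖a - b‖ ^ q + ‖b - c‖ ^ q := by
    have := Real.rpow_nonneg (norm_nonneg (a - b)) q
    have := Real.rpow_nonneg (norm_nonneg (b - c)) q
    rcases max_choice ‖a - b‖ ‖b - c‖ with h | h <;> rw [h] <;> linarith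
  calc ‖a - c‖ ^ q ≤ (2 * max ‖a - b‖ ‖b - c‖) ^ q :=
        Real.rpow_le_rpow (norm_nonneg _) h1 hq0
    _ = 2 ^ q * (max ‖a - b‖ ‖b - c‖) ^ q :=
        Real.mul_rpow (by norm_num) (le_max_of_le_left (norm_nonneg _))
    _ ≤ _ := by gcongr

lemma dh_block {f : ℕ → ℝ} (h0 : ∀ i, 0 ≤ f i) {l : ℕ → ℕ} (hl : StrictMono l) :
    Summable f ↔ Summable fun j => ∑ i ∈ Finset.Ico (l j) (l (j + 1)), f i := by
  have key : ∀ n, ∑ j ∈ Finset.range n, ∑ i ∈ Finset.Ico (l j) (l (j + 1)), f i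
      = ∑ i ∈ Finset.Ico (l 0) (l n), f i := by
    intro n
    induction n with
    | zero => simp
    | succ n ih =>
      rw [Finset.sum_range_succ, ih,
        Finset.sum_Ico_consecutive _ (hl.monotone (Nat.zero_le n)) (hl.monotone (Nat.le_succ n))]
  constructor
  · intro h
    refine summable_of_sum_range_le (c := ∑' i, f i) (fun j => Finset.sum_nonneg fun i _ => h0 i) ?_
    intro n
    rw [key]
    exact h.sum_le_tsum _ fun i _ => h0 i
  · intro h
    rw [← summable_nat_add_iff (l 0)]
    refine summable_of_sum_range_le (c := ∑' j, ∑ i ∈ Finset.Ico (l j) (l (j + 1)), f i)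
      (fun i => h0 _) ?_
    intro n
    have h2 : ∑ i ∈ Finset.range n, f (i + l 0) ≤ ∑ i ∈ Finset.Ico (l 0) (l n), f i := by
      have : ∑ i ∈ Finset.range n, f (i + l 0) = ∑ i ∈ Finset.Ico (l 0) (n + l 0), f i := by
        rw [Finset.sum_Ico_eq_sum_range]; simp [add_comm]
      rw [this]
      refine Finset.sum_le_sum_of_subset_of_nonneg ?_ (fun i _ _ => h0 i)
      refine Finset.Ico_subset_Ico le_rfl ?_
      have := hl.add_le_nat n 0
      simpa [add_comm] using this
    refine h2.trans ?_
    rw [← key]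
    exact h.sum_le_tsum _ fun j _ => Finset.sum_nonneg fun i _ => h0 i

lemma dh_core {Y : Type*} [NormedAddCommGroup Y]
    [TopologicalSpace.SeparableSpace Y] [MeasurableSpace Y] [BorelSpace Y]
    (q : ℝ) (hq : 1 ≤ q)
    (Z : ℕ → Type*) [∀ n, MetricSpace (Z n)] [∀ n, Finite (Z n)] [∀ n, Nonempty (Z n)]
    [∀ n, MeasurableSpace (Z n)] [∀ n, BorelSpace (Z n)]
    (θ : (∀ n, Z n) → (ℕ → Y)) (hθ : Measurable θ)
    (hfin : ∀ k r y, Summable fun i => ‖θ (dhMod k r y) i - θ y i‖ ^ q) :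
    ∃ b l : ℕ → ℕ, StrictMono b ∧ StrictMono l ∧ ∃ w : ∀ n, Z n, ∀ x : ∀ n, Z n,
      (∀ n, n ∉ Set.range b → x n = w n) → ∀ j,
      ∑ i ∈ Finset.Ico (l j) (l (j + 1)), ‖θ x i - θ (Function.update w (b j) (x (b j))) i‖ ^ q
        ≤ 2 ^ q * ((1 / 2) ^ j + (1 / 2) ^ j) := by
  have hq0 : 0 ≤ q := by linarith
  have hY : SecondCountableTopology Y := UniformSpace.secondCountable_of_separable Y
  obtain ⟨G0, hG0, hG0c⟩ := dh_continuousOn θ hθ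
  obtain ⟨t, htG, htδ, htd⟩ := mem_residual.1 hG0
  obtain ⟨U, hUo, rfl⟩ := isGδ_iff_eq_iInter_nat.1 htδ
  have hUd : ∀ n, Dense (U n) := fun n => htd.mono (Set.iInter_subset _ n)
  let G : Set (∀ n, Z n) := ⋂ a : ℕ × (Σ k : ℕ, ∀ i : Fin k, Z i), dhMod a.2.1 a.2.2 ⁻¹' U a.1
  have hGmem : ∀ x, x ∈ G ↔ ∀ n k r, dhMod k r x ∈ U n := by
    intro x
    simp only [G, Set.mem_iInter, Set.mem_preimage, Prod.forall, Sigma.forall]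
  have hGo : ∀ a : ℕ × (Σ k : ℕ, ∀ i : Fin k, Z i), IsOpen (dhMod a.2.1 a.2.2 ⁻¹' U a.1) :=
    fun a => (hUo a.1).preimage (dhMod_continuous _ _)
  have hGδ : IsGδ G := IsGδ.iInter_of_isOpen hGo
  have hGd : Dense G := dense_iInter_of_isOpen hGo fun a => dhMod_dense _ _ (hUd a.1)
  have hGsub : G ⊆ G0 := by
    intro x hx
    apply htG
    rw [Set.mem_iInter]
    intro n
    have := (hGmem x).1 hx n 0 (fun i => x i)
    have e : dhMod 0 (fun i => x i) x = x := funext fun i => dhMod_ge (Nat.zero_le i)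
    rwa [e] at this
  have hGc : ContinuousOn θ G := hG0c.mono hGsub
  have hGinv : ∀ k r, ∀ x ∈ G, dhMod k r x ∈ G := by
    intro k r x hx
    rw [hGmem] at hx ⊢
    intro n j s
    rw [dhMod_comp]
    exact hx _ _ _
  have hcoord : ∀ i, ContinuousOn (fun x => θ x i) G := fun i =>
    (continuous_apply i).comp_continuousOn hGc
  -- the sets for the tail claim
  let A : ℕ → ℕ → ℕ → Set (∀ n, Z n) := fun k j l =>
    {y | y ∈ G ∧ ∀ r M, ∑ i ∈ Finset.Ico l M, ‖θ (dhMod k r y) i - θ y i‖ ^ q ≤ (1 / 2) ^ j}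
  have hAcl : ∀ k j l y, y ∈ G → y ∈ closure (A k j l) → y ∈ A k j l := by
    intro k j l y hy hyc
    refine ⟨hy, fun r M => ?_⟩
    have hc : ContinuousOn
        (fun y => ∑ i ∈ Finset.Ico l M, ‖θ (dhMod k r y) i - θ y i‖ ^ q) G := by
      refine continuousOn_finsetSum _ fun i _ => ?_
      refine ContinuousOn.rpow_const ?_ fun _ _ => Or.inr hq0
      exact (((hcoord i).comp (dhMod_continuous k r).continuousOn
        (fun x hx => hGinv k r x hx)).sub (hcoord i)).norm
    have hAG : A k j l ⊆ G := fun y hy => hy.1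
    exact ((hc y hy).mono hAG).closure_le hyc continuousWithinAt_const fun z hz => hz.2 r M
  have hAcov : ∀ k j, G ⊆ ⋃ l, closure (A k j l) := by
    intro k j y hy
    have : ∀ᶠ l in atTop, ∀ r : (∀ i : Fin k, Z i), ∀ M,
        ∑ i ∈ Finset.Ico l M, ‖θ (dhMod k r y) i - θ y i‖ ^ q ≤ (1 / 2) ^ j := by
      rw [eventually_all]
      intro r
      exact dh_summable_tail (hfin k r y) (fun i => Real.rpow_nonneg (norm_nonneg _) _)
        (by positivity)
    obtain ⟨l, hl⟩ := this.exists
    exact Set.mem_iUnion.2 ⟨l, subset_closure ⟨hy, hl⟩⟩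
  have hVd : ∀ a : ℕ × ℕ, Dense (⋃ l, interior (closure (A a.1 a.2 l))) := fun a =>
    hGδ.dense_iUnion_interior_of_closed hGd (fun l => isClosed_closure) (hAcov a.1 a.2)
  have hVo : ∀ a : ℕ × ℕ, IsOpen (⋃ l, interior (closure (A a.1 a.2 l))) := fun a =>
    isOpen_iUnion fun l => isOpen_interior
  obtain ⟨w, hwG, hwV⟩ := (Dense.inter_of_Gδ hGδ (IsGδ.iInter_of_isOpen hVo) hGd
    (dense_iInter_of_isOpen hVo hVd)).nonempty
  rw [Set.mem_iInter] at hwV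
  -- one step of the construction
  have step : ∀ j k L : ℕ, ∃ l b : ℕ, L < l ∧ k ≤ b ∧
      (∀ y ∈ G, (∀ i < b, y i = w i) → ∀ r M,
        ∑ i ∈ Finset.Ico l M, ‖θ (dhMod k r y) i - θ y i‖ ^ q ≤ (1 / 2) ^ j) ∧
      (∀ r, ∀ x ∈ G, (∀ i < b, x i = dhMod k r w i) →
        ∑ i ∈ Finset.range l, ‖θ x i - θ (dhMod k r w) i‖ ^ q ≤ (1 / 2) ^ (j - 1)) ∧
      (∀ r x, (∀ i < b, x i = dhMod k r w i) → ∀ n ≤ j, x ∈ U n) := by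
    intro j k L
    obtain ⟨l0, hl0⟩ := Set.mem_iUnion.1 (hwV (k, j))
    have e1 := dh_nhds (mem_interior_iff_mem_nhds.1 hl0)
    let l := max l0 (L + 1)
    have e2 : ∀ᶠ N in atTop, ∀ r : (∀ i : Fin k, Z i), ∀ x, (∀ i < N, x i = dhMod k r w i) →
        x ∈ G → ∑ i ∈ Finset.range l, ‖θ x i - θ (dhMod k r w) i‖ ^ q ≤ (1 / 2) ^ (j - 1) := by
      rw [eventually_all]
      intro r
      have hc : ContinuousOn
          (fun x => ∑ i ∈ Finset.range l, ‖θ x i - θ (dhMod k r w) i‖ ^ q) G := by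
        refine continuousOn_finsetSum _ fun i _ => ?_
        refine ContinuousOn.rpow_const ?_ fun _ _ => Or.inr hq0
        exact ((hcoord i).sub continuousOn_const).norm
      have h1 := hc _ (hGinv k r w hwG)
      have h2 : ∑ i ∈ Finset.range l, ‖θ (dhMod k r w) i - θ (dhMod k r w) i‖ ^ q
          < (1 / 2) ^ (j - 1) := by
        simp only [sub_self, norm_zero, Real.zero_rpow (by linarith : q ≠ 0), Finset.sum_const_zero]
        positivity
      have h3 := h1.eventually (gt_mem_nhds h2)
      rw [eventually_nhdsWithin_iff] at h3
      filter_upwards [dh_nhds h3] with N hN x hx hxG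
      exact (hN x hx hxG).le
    have e3 : ∀ᶠ N in atTop, ∀ r : (∀ i : Fin k, Z i), ∀ n : Fin (j + 1), ∀ x,
        (∀ i < N, x i = dhMod k r w i) → x ∈ U n := by
      rw [eventually_all]
      intro r
      rw [eventually_all]
      intro n
      exact dh_nhds ((hUo n).mem_nhds ((hGmem w).1 hwG n k r))
    obtain ⟨b, h1, h2, h3, h4⟩ := (e1.and (e2.and (e3.and (eventually_ge_atTop k)))).exists
    refine ⟨l, b, by omega, h4, ?_, fun r x hx hxw => h2 r x hxw hx, ?_⟩
    · intro y hy hyw r M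
      have := (hAcl k j l0 y hy (h1 y hyw)).2 r M
      refine le_trans ?_ this
      exact Finset.sum_le_sum_of_subset_of_nonneg
        (Finset.Ico_subset_Ico (le_max_left _ _) le_rfl)
        (fun i _ _ => Real.rpow_nonneg (norm_nonneg _) _)
    · intro r x hx n hn
      exact h3 r ⟨n, by omega⟩ x hx
  choose lf bf hL hk H1 H2 H3 using step
  let S : ℕ → ℕ × ℕ := fun j => Nat.rec (lf 0 0 0, bf 0 0 0)
    (fun j s => (lf (j + 1) (s.2 + 1) s.1, bf (j + 1) (s.2 + 1) s.1)) j
  let l : ℕ → ℕ := fun j => (S j).1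
  let b : ℕ → ℕ := fun j => (S j).2
  have hls : ∀ j, l (j + 1) = lf (j + 1) (b j + 1) (l j) := fun j => rfl
  have hbs : ∀ j, b (j + 1) = bf (j + 1) (b j + 1) (l j) := fun j => rfl
  have hb : StrictMono b := strictMono_nat_of_lt_succ fun j => by
    rw [hbs]; exact hk (j + 1) (b j + 1) (l j)
  have hl : StrictMono l := strictMono_nat_of_lt_succ fun j => by
    rw [hls]; exact hL (j + 1) (b j + 1) (l j)
  have hgap : ∀ j i, b j < i → i < b (j + 1) → i ∉ Set.range b := by
    rintro j i h1 h2 ⟨m, rfl⟩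
    have := (hb.lt_iff_lt (a := j) (b := m)).1 h1
    have := (hb.lt_iff_lt (a := m) (b := j + 1)).1 h2
    omega
  refine ⟨b, l, hb, hl, w, ?_⟩
  intro x hx j
  have hxG : x ∈ G := by
    rw [hGmem]
    intro n k r
    let m := max n k
    have hm : k ≤ b m := le_trans (le_max_right _ _) (hb.id_le m)
    refine H3 (m + 1) (b m + 1) (l m) (fun i => dhMod k r x i) _ ?_ n (by omega)
    intro i hi
    rw [← hbs] at hi
    by_cases h : i < b m + 1
    · rw [dhMod_lt h]
    · rw [dhMod_ge (by omega), dhMod_ge (by omega), hx i (hgap m i (by omega) hi)]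
  let v : ∀ n, Z n := dhMod (b j) (fun i => w i) x
  have hvG : v ∈ G := hGinv _ _ _ hxG
  have hvw : ∀ i < b j, v i = w i := fun i hi => dhMod_lt hi
  -- first comparison
  have c1 : ∀ M, ∑ i ∈ Finset.Ico (l j) M, ‖θ x i - θ v i‖ ^ q ≤ (1 / 2) ^ j := by
    intro M
    rcases j with _ | j
    · have hxv : dhMod 0 (fun i => x i) v = x := by
        funext i
        rw [dhMod_ge (Nat.zero_le i)]
        by_cases h : i < b 0
        · rw [hvw i h, hx]
          rintro ⟨m, rfl⟩
          have := (hb.lt_iff_lt (a := m) (b := 0)).1 h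
          omega
        · exact dhMod_ge (by omega)
      have := H1 0 0 0 v hvG hvw (fun i => x i) M
      rwa [hxv] at this
    · have hxv : dhMod (b j + 1) (fun i => x i) v = x := by
        funext i
        by_cases h : i < b j + 1
        · rw [dhMod_lt h]
        · rw [dhMod_ge (by omega)]
          by_cases h' : i < b (j + 1)
          · rw [hvw i h', hx i (hgap j i (by omega) h')]
          · exact dhMod_ge (by omega)
      have := H1 (j + 1) (b j + 1) (l j) v hvG hvw (fun i => x i) M
      rwa [hxv] at this
  -- second comparison
  have hup : dhMod (b j + 1) (fun i => v i) w = Function.update w (b j) (x (b j)) := by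
    funext i
    rcases lt_trichotomy i (b j) with h | h | h
    · rw [dhMod_lt (by omega), Function.update_of_ne h.ne]; exact hvw i h
    · subst h
      rw [dhMod_lt (by omega), Function.update_self]; exact dhMod_ge le_rfl
    · rw [dhMod_ge (by omega), Function.update_of_ne h.ne']
  have c2 : ∑ i ∈ Finset.range (l (j + 1)),
      ‖θ v i - θ (Function.update w (b j) (x (b j))) i‖ ^ q ≤ (1 / 2) ^ j := by
    rw [← hup]
    refine H2 (j + 1) (b j + 1) (l j) (fun i => v i) v hvG ?_
    intro i hi
    rw [← hbs] at hi
    by_cases h : i < b j + 1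
    · rw [dhMod_lt h]
    · rw [dhMod_ge (by omega), ← hx i (hgap j i (by omega) hi)]
      exact dhMod_ge (by omega)
  calc _ ≤ ∑ i ∈ Finset.Ico (l j) (l (j + 1)), 2 ^ q * (‖θ x i - θ v i‖ ^ q +
          ‖θ v i - θ (Function.update w (b j) (x (b j))) i‖ ^ q) :=
        Finset.sum_le_sum fun i _ => dh_rpow hq _ _ _
    _ = 2 ^ q * (∑ i ∈ Finset.Ico (l j) (l (j + 1)), ‖θ x i - θ v i‖ ^ q +
          ∑ i ∈ Finset.Ico (l j) (l (j + 1)),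
            ‖θ v i - θ (Function.update w (b j) (x (b j))) i‖ ^ q) := by
        rw [← Finset.mul_sum, Finset.sum_add_distrib]
    _ ≤ _ := by
        refine mul_le_mul_of_nonneg_left (add_le_add (c1 _) (le_trans ?_ c2)) (by positivity)
        refine Finset.sum_le_sum_of_subset_of_nonneg ?_
          (fun i _ _ => Real.rpow_nonneg (norm_nonneg _) _)
        intro i hi
        simp only [Finset.mem_Ico] at hi
        exact Finset.mem_range.2 hi.2

theorem dougherty_hjorth_lemma {Y : Type*} [NormedAddCommGroup Y] [NormedSpace ℝ Y]
    [CompleteSpace Y] [TopologicalSpace.SeparableSpace Y] [MeasurableSpace Y] [BorelSpace Y]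
    (p q : ℝ) (hp : p = 0 ∨ 1 ≤ p) (hq : 1 ≤ q)
    (Z : ℕ → Type*) [∀ n, MetricSpace (Z n)] [∀ n, Finite (Z n)]
    [∀ n, MeasurableSpace (Z n)] [∀ n, BorelSpace (Z n)]
    (hred : BorelReducible
      (fun x y : ∀ n, Z n =>
        if p = 0 then Tendsto (fun n => dist (x n) (y n)) atTop (𝓝 0)
        else Summable fun n => dist (x n) (y n) ^ p)
      (fun x y : ℕ → Y => Summable fun n => ‖x n - y n‖ ^ q)) :
    ∃ b l : ℕ → ℕ, StrictMono b ∧ StrictMono l ∧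
      ∃ T : ∀ j, Z (b j) → (Fin (l (j+1) - l j) → Y),
        ∀ x y : ∀ j, Z (b j),
          ((if p = 0 then Tendsto (fun j => dist (x j) (y j)) atTop (𝓝 0)
            else Summable fun j => dist (x j) (y j) ^ p) ↔
            Summable fun j =>
              ((∑ i, ‖T j (x j) i - T j (y j) i‖ ^ q) ^ (1/q)) ^ q) := by
  classical
  have hq0 : 0 ≤ q := by linarith
  have hq1 : q ≠ 0 := by linarith
  by_cases hne : ∀ n, Nonempty (Z n)
  swap
  · obtain ⟨n0, h0⟩ := not_forall.1 hne
    rw [not_nonempty_iff] at h0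
    refine ⟨fun j => n0 + j, fun j => j, fun a b h => by simpa using h, fun a b h => h,
      fun j _ _ => 0, fun x => ?_⟩
    exact (h0.false (x 0)).elim
  obtain ⟨θ, hθ, hE⟩ := hred
  beta_reduce at hE
  have hfin : ∀ k r y, Summable fun i => ‖θ (dhMod k r y) i - θ y i‖ ^ q := by
    intro k r y
    rw [← hE]
    have hz : ∀ n, k ≤ n → dist (dhMod k r y n) (y n) = 0 := by
      intro n hn
      rw [dhMod_ge hn, dist_self]
    split_ifs with hp0
    · refine tendsto_const_nhds.congr' ?_
      filter_upwards [eventually_ge_atTop k] with n hn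
      rw [hz n hn]
    · refine summable_of_ne_finset_zero (s := Finset.range k) ?_
      intro n hn
      rw [hz n (by simpa using hn), Real.zero_rpow hp0]
  obtain ⟨b, l, hb, hl, w, hw⟩ := dh_core q hq Z θ hθ hfin
  refine ⟨b, l, hb, hl, fun j z i => θ (Function.update w (b j) z) (l j + i), ?_⟩
  have hext : ∀ x : (∀ j, Z (b j)), ∃ X : ∀ n, Z n, (∀ j, X (b j) = x j) ∧
      ∀ n, n ∉ Set.range b → X n = w n := by
    intro x
    have : ∀ n, ∃ z : Z n, (∀ j, b j = n → HEq z (x j)) ∧ (n ∉ Set.range b → z = w n) := by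
      intro n
      by_cases h : n ∈ Set.range b
      · obtain ⟨j, rfl⟩ := h
        refine ⟨x j, fun i hi => ?_, fun h => (h ⟨j, rfl⟩).elim⟩
        rw [hb.injective hi]
      · exact ⟨w n, fun j hj => (h ⟨j, hj⟩).elim, fun _ => rfl⟩
    choose X hX1 hX2 using this
    exact ⟨X, fun j => eq_of_heq (hX1 _ j rfl), hX2⟩
  intro x y
  obtain ⟨X, hX, hXw⟩ := hext x
  obtain ⟨V, hV, hVw⟩ := hext y
  have hoff : ∀ n, n ∉ Set.range b → dist (X n) (V n) = 0 := by
    intro n hn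
    rw [hXw n hn, hVw n hn, dist_self]
  have hleft : (if p = 0 then Tendsto (fun j => dist (x j) (y j)) atTop (𝓝 0)
            else Summable fun j => dist (x j) (y j) ^ p) ↔
      (if p = 0 then Tendsto (fun n => dist (X n) (V n)) atTop (𝓝 0)
        else Summable fun n => dist (X n) (V n) ^ p) := by
    have hxy : ∀ j, dist (x j) (y j) = dist (X (b j)) (V (b j)) := fun j => by rw [hX, hV]
    simp only [hxy]
    split_ifs with hp0
    · constructor
      · intro h
        rw [Metric.tendsto_atTop] at h ⊢
        intro ε hε
        obtain ⟨J, hJ⟩ := h ε hε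
        refine ⟨b J, fun n hn => ?_⟩
        by_cases hnr : n ∈ Set.range b
        · obtain ⟨j, rfl⟩ := hnr
          exact hJ j (hb.le_iff_le.1 hn)
        · rw [hoff n hnr]; simpa using hε
      · intro h
        exact h.comp hb.tendsto_atTop
    · exact hb.injective.summable_iff (f := fun n => dist (X n) (V n) ^ p)
        (fun n hn => by rw [hoff n hn, Real.zero_rpow hp0])
  rw [hleft, hE, dh_block (fun i => Real.rpow_nonneg (norm_nonneg _) _) hl]
  have hsum : ∀ j, ((∑ i : Fin (l (j+1) - l j), ‖θ (Function.update w (b j) (x j)) (l j + i) -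
      θ (Function.update w (b j) (y j)) (l j + i)‖ ^ q) ^ (1/q)) ^ q =
      ∑ i ∈ Finset.Ico (l j) (l (j + 1)), ‖θ (Function.update w (b j) (x j)) i -
        θ (Function.update w (b j) (y j)) i‖ ^ q := by
    intro j
    rw [← Real.rpow_mul (Finset.sum_nonneg fun i _ => Real.rpow_nonneg (norm_nonneg _) _),
      one_div_mul_cancel hq1, Real.rpow_one, Finset.sum_Ico_eq_sum_range]
    exact Fin.sum_univ_eq_sum_range (fun i => ‖θ (Function.update w (b j) (x j)) (l j + i) -
      θ (Function.update w (b j) (y j)) (l j + i)‖ ^ q) _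
  simp only [hsum]
  have hx := hw X hXw
  have hy := hw V hVw
  simp only [hX] at hx
  simp only [hV] at hy
  have hgeo : Summable fun j : ℕ => (2:ℝ) ^ q * ((1 / 2) ^ j + (1 / 2) ^ j) :=
    (summable_geometric_two.add summable_geometric_two).mul_left _
  have main : ∀ (a c d e : ℕ → ℕ → Y),
      (∀ j, ∑ i ∈ Finset.Ico (l j) (l (j + 1)), ‖a j i - c j i‖ ^ q
        ≤ 2 ^ q * ((1 / 2) ^ j + (1 / 2) ^ j)) →
      (∀ j, ∑ i ∈ Finset.Ico (l j) (l (j + 1)), ‖d j i - e j i‖ ^ q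
        ≤ 2 ^ q * ((1 / 2) ^ j + (1 / 2) ^ j)) →
      (Summable fun j => ∑ i ∈ Finset.Ico (l j) (l (j + 1)), ‖c j i - d j i‖ ^ q) →
      Summable fun j => ∑ i ∈ Finset.Ico (l j) (l (j + 1)), ‖a j i - e j i‖ ^ q := by
    intro a c d e h1 h2 h3
    refine Summable.of_nonneg_of_le
      (fun j => Finset.sum_nonneg fun i _ => Real.rpow_nonneg (norm_nonneg _) _) (fun j => ?_)
      ((hgeo.add ((h3.add hgeo).mul_left (2 ^ q))).mul_left (2 ^ q))
    calc _ ≤ ∑ i ∈ Finset.Ico (l j) (l (j + 1)), 2 ^ q * (‖a j i - c j i‖ ^ q +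
          2 ^ q * (‖c j i - d j i‖ ^ q + ‖d j i - e j i‖ ^ q)) := by
          refine Finset.sum_le_sum fun i _ => (dh_rpow hq _ (c j i) _).trans ?_
          have := dh_rpow hq (c j i) (d j i) (e j i)
          gcongr
      _ = 2 ^ q * (∑ i ∈ Finset.Ico (l j) (l (j + 1)), ‖a j i - c j i‖ ^ q +
          2 ^ q * (∑ i ∈ Finset.Ico (l j) (l (j + 1)), ‖c j i - d j i‖ ^ q +
            ∑ i ∈ Finset.Ico (l j) (l (j + 1)), ‖d j i - e j i‖ ^ q)) := by
          rw [← Finset.mul_sum, Finset.sum_add_distrib, ← Finset.mul_sum, Finset.sum_add_distrib]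
      _ ≤ _ := by
          have := h1 j
          have := h2 j
          gcongr
  constructor
  · refine main _ (fun _ i => θ X i) (fun _ i => θ V i) _ ?_ hy
    intro j
    simpa only [norm_sub_rev] using hx j
  · refine main (fun _ i => θ X i) _ _ (fun _ i => θ V i) hx ?_
    intro j
    simpa only [norm_sub_rev] using hy j
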